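/- Vanishing expectation from Haar invariance: Let N ≥ 1, let A and B be deterministic N×N Hermitian matrices, let U be Haar distributed on the unitary group U(N), set B̃ = UBU* and G(z) = (A + B̃ − z)^{-1} for z ∈ ℂ⁺, and let tr denote the normalized trace N^{-1}Tr. Then for every i ∈ {1,…,N} and every z ∈ ℂ⁺, E[(B̃ G(z))_{ii} · tr G(z) − G_{ii}(z) · tr(B̃ G(z))] = 0. -/

import Mathlib

open MeasureTheory Complex Filter Matrix Set Topology

noncomputable section

namespace RMT

/-- The open upper half-plane. -/
def UHP : Set ℂ := {z : ℂ | 0 < z.im}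

/-- Stieltjes transform of a measure on `ℝ`. -/
def stT (μ : Measure ℝ) (z : ℂ) : ℂ := ∫ x, ((x : ℂ) - z)⁻¹ ∂μ

/-- Negative reciprocal Stieltjes transform. -/
def Fm (μ : Measure ℝ) (z : ℂ) : ℂ := -(stT μ z)⁻¹

/-- `ω₁, ω₂` are the subordination functions of the pair `(μ₁, μ₂)`. -/
structure IsSubordination (μ₁ μ₂ : Measure ℝ) (ω₁ ω₂ : ℂ → ℂ) : Prop where
  diff₁ : DifferentiableOn ℂ ω₁ UHP
  diff₂ : DifferentiableOn ℂ ω₂ UHP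
  imge₁ : ∀ z ∈ UHP, z.im ≤ (ω₁ z).im
  imge₂ : ∀ z ∈ UHP, z.im ≤ (ω₂ z).im
  lim₁ : Tendsto (fun η : ℝ => ω₁ ((η : ℂ) * Complex.I) / ((η : ℂ) * Complex.I)) atTop (nhds 1)
  lim₂ : Tendsto (fun η : ℝ => ω₂ ((η : ℂ) * Complex.I) / ((η : ℂ) * Complex.I)) atTop (nhds 1)
  subeq : ∀ z ∈ UHP, Fm μ₁ (ω₂ z) = Fm μ₂ (ω₁ z)
  sumeq : ∀ z ∈ UHP, Fm μ₁ (ω₂ z) = ω₁ z + ω₂ z - z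

/-- `ν` is the free additive convolution `μ₁ ⊞ μ₂`, witnessed by the subordination
functions `ω₁, ω₂`. -/
structure IsFreeConv (μ₁ μ₂ ν : Measure ℝ) (ω₁ ω₂ : ℂ → ℂ) : Prop where
  sub : IsSubordination μ₁ μ₂ ω₁ ω₂
  prob : IsProbabilityMeasure ν
  conv : ∀ z ∈ UHP, Fm ν z = Fm μ₁ (ω₂ z)

/-- Support of a Borel measure on `ℝ`. -/
def msupp (μ : Measure ℝ) : Set ℝ := {x : ℝ | ∀ ε > 0, μ (Set.Ioo (x - ε) (x + ε)) ≠ 0}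

instance matMeasurableSpace (N : ℕ) : MeasurableSpace (Matrix (Fin N) (Fin N) ℂ) :=
  (inferInstance : MeasurableSpace (Fin N → Fin N → ℂ))

/-- A probability measure on `N×N` complex matrices which is concentrated on the unitary
group and invariant under left translation by unitary matrices, i.e. the Haar measure
of `U(N)` viewed as a measure on matrix space. -/
def IsHaarUnitary {N : ℕ} (P : Measure (Matrix (Fin N) (Fin N) ℂ)) : Prop :=
  IsProbabilityMeasure P ∧
  P {U | U ∈ Matrix.unitaryGroup (Fin N) ℂ} = 1 ∧
  ∀ V ∈ Matrix.unitaryGroup (Fin N) ℂ, P.map (fun U => V * U) = P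

/-- `B̃ = U B U*`. -/
def BtMat {N : ℕ} (bv : Fin N → ℝ) (U : Matrix (Fin N) (Fin N) ℂ) :
    Matrix (Fin N) (Fin N) ℂ :=
  U * Matrix.diagonal (fun i => (bv i : ℂ)) * Uᴴ

/-- `H = A + U B U*`. -/
def Hmat {N : ℕ} (av bv : Fin N → ℝ) (U : Matrix (Fin N) (Fin N) ℂ) :
    Matrix (Fin N) (Fin N) ℂ :=
  Matrix.diagonal (fun i => (av i : ℂ)) + BtMat bv U

/-- Green function `G(z) = (H - z)⁻¹`. -/
def Gmat {N : ℕ} (av bv : Fin N → ℝ) (U : Matrix (Fin N) (Fin N) ℂ) (z : ℂ) :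
    Matrix (Fin N) (Fin N) ℂ :=
  (Hmat av bv U - z • (1 : Matrix (Fin N) (Fin N) ℂ))⁻¹

/-- Normalized trace. -/
def ntr {N : ℕ} (M : Matrix (Fin N) (Fin N) ℂ) : ℂ := (N : ℂ)⁻¹ * Matrix.trace M

/-- `m_H(z) = tr G(z)`. -/
def mHf {N : ℕ} (av bv : Fin N → ℝ) (U : Matrix (Fin N) (Fin N) ℂ) (z : ℂ) : ℂ :=
  ntr (Gmat av bv U z)

instance matBorelSpace (N : ℕ) : BorelSpace (Matrix (Fin N) (Fin N) ℂ) :=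
  inferInstanceAs (BorelSpace (Fin N → Fin N → ℂ))

lemma isCompact_unitaryGroup (N : ℕ) :
    IsCompact {U : Matrix (Fin N) (Fin N) ℂ | U ∈ Matrix.unitaryGroup (Fin N) ℂ} := by
  have hK : IsCompact (Set.univ.pi fun _ : Fin N => Set.univ.pi fun _ : Fin N =>
      Metric.closedBall (0 : ℂ) 1) :=
    isCompact_univ_pi fun _ => isCompact_univ_pi fun _ => isCompact_closedBall _ _
  refine IsCompact.of_isClosed_subset hK ?_ ?_
  · simp_rw [Matrix.mem_unitaryGroup_iff, Matrix.star_eq_conjTranspose]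
    exact isClosed_eq (continuous_id.matrix_mul continuous_id.matrix_conjTranspose)
      continuous_const
  · intro U hU i _ j _
    simpa using entry_norm_bound_of_unitary hU i j

section Resolvent

variable {N : ℕ} {A B H : Matrix (Fin N) (Fin N) ℂ} {z : ℂ}

lemma isUnit_sub_smul_one (hH : H.IsHermitian) (hz : z.im ≠ 0) :
    IsUnit (H - z • (1 : Matrix (Fin N) (Fin N) ℂ)) := by
  have hmem : z ∉ spectrum ℂ H := by
    rw [hH.spectrum_eq_image_range]
    rintro ⟨x, -, rfl⟩
    exact hz (Complex.ofReal_im x)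
  have := (spectrum.notMem_iff.1 hmem).neg
  rwa [neg_sub, Algebra.algebraMap_eq_smul_one] at this

lemma continuous_resolvent {α : Type*} [TopologicalSpace α]
    {f : α → Matrix (Fin N) (Fin N) ℂ} (hf : Continuous f) (hH : ∀ x, (f x).IsHermitian)
    (hz : z.im ≠ 0) :
    Continuous fun x => (f x - z • (1 : Matrix (Fin N) (Fin N) ℂ))⁻¹ := by
  have hc : Continuous fun x => f x - z • (1 : Matrix (Fin N) (Fin N) ℂ) :=
    hf.sub continuous_const
  simp only [Matrix.inv_def, Ring.inverse_eq_inv']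
  exact (hc.matrix_det.inv₀ fun x => ((Matrix.isUnit_iff_isUnit_det _).1
    (isUnit_sub_smul_one (hH x) hz)).ne_zero).smul hc.matrix_adjugate

lemma isHermitian_add_conj (hA : A.IsHermitian) (hB : B.IsHermitian)
    (U : Matrix (Fin N) (Fin N) ℂ) : (A + U * B * Uᴴ).IsHermitian :=
  hA.add (Matrix.isHermitian_mul_mul_conjTranspose U hB)

lemma continuous_conj (B : Matrix (Fin N) (Fin N) ℂ) :
    Continuous fun U : Matrix (Fin N) (Fin N) ℂ => U * B * Uᴴ :=
  (continuous_id.matrix_mul continuous_const).matrix_mul continuous_id.matrix_conjTranspose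

lemma continuous_resolvent_conj (hA : A.IsHermitian) (hB : B.IsHermitian) (hz : z.im ≠ 0) :
    Continuous fun U : Matrix (Fin N) (Fin N) ℂ =>
      (A + U * B * Uᴴ - z • (1 : Matrix (Fin N) (Fin N) ℂ))⁻¹ :=
  continuous_resolvent (continuous_const.add (continuous_conj B))
    (isHermitian_add_conj hA hB) hz

/-- The matrix `(tK + i)⁻¹`, from which the Cayley transform of `tK` is built. -/
def cayleyInv (K : Matrix (Fin N) (Fin N) ℂ) (t : ℝ) : Matrix (Fin N) (Fin N) ℂ :=
  (t • K - (-I) • (1 : Matrix (Fin N) (Fin N) ℂ))⁻¹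

/-- The Cayley transform `(tK - i)(tK + i)⁻¹`. -/
def cayley (K : Matrix (Fin N) (Fin N) ℂ) (t : ℝ) : Matrix (Fin N) (Fin N) ℂ :=
  1 - (2 * I) • cayleyInv K t

variable {K : Matrix (Fin N) (Fin N) ℂ}

lemma isHermitian_real_smul (hK : K.IsHermitian) (t : ℝ) : (t • K).IsHermitian := by
  rw [Matrix.IsHermitian, Matrix.conjTranspose_smul, hK.eq, star_trivial]

lemma continuous_cayleyInv (hK : K.IsHermitian) : Continuous (cayleyInv K) :=
  continuous_resolvent (continuous_id.smul continuous_const) (isHermitian_real_smul hK)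
    (by simp)

lemma continuous_cayley (hK : K.IsHermitian) : Continuous (cayley K) :=
  continuous_const.sub ((continuous_cayleyInv hK).fun_const_smul (2 * I))

lemma mul_cayleyInv (hK : K.IsHermitian) (t : ℝ) :
    t • (K * cayleyInv K t) + I • cayleyInv K t = 1 := by
  have h := Matrix.mul_nonsing_inv _ ((Matrix.isUnit_iff_isUnit_det _).1
    (isUnit_sub_smul_one (z := -I) (isHermitian_real_smul hK t) (by simp)))
  rw [← h, ← cayleyInv, sub_mul, Matrix.smul_mul, Matrix.smul_mul, Matrix.one_mul]
  simp

lemma cayleyInv_eq (hK : K.IsHermitian) (t : ℝ) :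
    cayleyInv K t = (-I) • 1 + (I * t) • (K * cayleyInv K t) := by
  rw [← mul_cayleyInv hK t, smul_add, smul_smul, ← Complex.coe_smul, smul_smul]
  simp

lemma cayleyInv_zero (hK : K.IsHermitian) : cayleyInv K 0 = (-I) • 1 := by
  simpa using cayleyInv_eq hK 0

lemma cayley_mem_unitaryGroup (hK : K.IsHermitian) (t : ℝ) :
    cayley K t ∈ Matrix.unitaryGroup (Fin N) ℂ := by
  rw [Matrix.mem_unitaryGroup_iff', Matrix.star_eq_conjTranspose, cayley]
  set C := cayleyInv K t with hC
  have h1 : t • (K * C) + I • C = 1 := mul_cayleyInv hK t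
  have h2 : t • (Cᴴ * K) - I • Cᴴ = 1 := by
    have := congrArg Matrix.conjTranspose h1
    simpa [Matrix.conjTranspose_smul, hK.eq, sub_eq_add_neg] using this
  have h3 : Cᴴ - C = (2 * I) • (Cᴴ * C) := by
    have e1 : Cᴴ = t • (Cᴴ * K * C) + I • (Cᴴ * C) := by
      conv_lhs => rw [← Matrix.mul_one Cᴴ, ← h1]
      simp [Matrix.mul_add, Matrix.mul_assoc]
    have e2 : C = t • (Cᴴ * K * C) - I • (Cᴴ * C) := by
      conv_lhs => rw [← Matrix.one_mul C, ← h2]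
      simp [Matrix.sub_mul, Matrix.mul_assoc]
    rw [mul_smul, two_smul]
    linear_combination (norm := module) e1 - e2
  have h4 : (1 - (2 * I) • C)ᴴ * (1 - (2 * I) • C) =
      1 + (2 * I) • (Cᴴ - C) - (2 * I * (2 * I)) • (Cᴴ * C) := by
    simp only [Matrix.conjTranspose_sub, Matrix.conjTranspose_smul, Matrix.conjTranspose_one,
      star_def, map_mul, conj_I, map_ofNat, Matrix.sub_mul, Matrix.mul_sub, Matrix.one_mul,
      Matrix.mul_one, Matrix.smul_mul, Matrix.mul_smul]
    module
  rw [h4, h3, smul_smul]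
  simp

lemma cayley_commutator (hK : K.IsHermitian) (t : ℝ) (M : Matrix (Fin N) (Fin N) ℂ) :
    cayley K t * M - M * cayley K t =
      (2 * t : ℂ) • (K * cayleyInv K t * M - M * (K * cayleyInv K t)) := by
  have h : cayley K t = (-1 : ℂ) • 1 + (2 * t : ℂ) • (K * cayleyInv K t) := by
    rw [cayley]
    nth_rw 1 [cayleyInv_eq hK t]
    rw [smul_add, smul_smul, smul_smul,
      show 2 * I * -I = 2 by linear_combination (-2) * I_mul_I,
      show 2 * I * (I * t) = -(2 * t) by linear_combination (2 * t : ℂ) * I_mul_I]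
    module
  rw [h]
  simp only [Matrix.add_mul, Matrix.mul_add, Matrix.smul_mul, Matrix.mul_smul, Matrix.one_mul,
    Matrix.mul_one]
  module

/-- Resolvent identity for the conjugation of `U B U*` by a Cayley transform. -/
lemma resolvent_sub_resolvent_cayley (hA : A.IsHermitian) (hB : B.IsHermitian)
    (hK : K.IsHermitian) (hz : z.im ≠ 0) (t : ℝ) (U : Matrix (Fin N) (Fin N) ℂ) :
    (A + U * B * Uᴴ - z • (1 : Matrix (Fin N) (Fin N) ℂ))⁻¹ -
      (A + (cayley K t * U) * B * (cayley K t * U)ᴴ - z • (1 : Matrix (Fin N) (Fin N) ℂ))⁻¹ =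
    (2 * t : ℂ) • ((A + (cayley K t * U) * B * (cayley K t * U)ᴴ -
        z • (1 : Matrix (Fin N) (Fin N) ℂ))⁻¹ *
      ((K * cayleyInv K t * (U * B * Uᴴ) - (U * B * Uᴴ) * (K * cayleyInv K t)) *
        (cayley K t)ᴴ) * (A + U * B * Uᴴ - z • (1 : Matrix (Fin N) (Fin N) ℂ))⁻¹) := by
  have hu := isUnit_sub_smul_one (isHermitian_add_conj hA hB U) hz
  have hv := isUnit_sub_smul_one (isHermitian_add_conj hA hB (cayley K t * U)) hz
  have hV : cayley K t * (cayley K t)ᴴ = 1 := by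
    simpa [Matrix.star_eq_conjTranspose] using
      Matrix.mem_unitaryGroup_iff.1 (cayley_mem_unitaryGroup hK t)
  have hconj : (cayley K t * U) * B * (cayley K t * U)ᴴ - U * B * Uᴴ =
      (2 * t : ℂ) • ((K * cayleyInv K t * (U * B * Uᴴ) - (U * B * Uᴴ) * (K * cayleyInv K t)) *
        (cayley K t)ᴴ) := by
    rw [← Matrix.smul_mul, ← cayley_commutator hK, Matrix.sub_mul, Matrix.mul_assoc (U * B * Uᴴ),
      hV, Matrix.mul_one, Matrix.conjTranspose_mul]
    simp only [Matrix.mul_assoc]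
  rw [← neg_sub (_⁻¹) (_⁻¹), Matrix.inv_sub_inv ⟨fun _ => hu, fun _ => hv⟩, sub_sub_sub_cancel_right,
    add_sub_add_left_eq_sub, ← neg_sub (_ * B * _), hconj]
  simp only [Matrix.mul_neg, Matrix.neg_mul, neg_neg, Matrix.mul_smul, Matrix.smul_mul]

end Resolvent

lemma mul_single_commutator_mul_apply {n R : Type*} [Fintype n] [DecidableEq n] [CommRing R]
    (G M : Matrix n n R) (k i : n) :
    (G * (Matrix.single k i (1 : R) * M - M * Matrix.single k i (1 : R)) * G) k i =
      G k k * (M * G) i i - (G * M) k k * G i i := by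
  have h : ∀ X Y : Matrix n n R, (X * Matrix.single k i (1 : R) * Y) k i = X k k * Y i i := by
    intro X Y
    simp [Matrix.mul_apply, Matrix.single_apply, Finset.sum_ite_eq, ite_and]
  rw [Matrix.mul_sub, Matrix.sub_mul, Matrix.sub_apply, ← h, ← h]
  simp only [Matrix.mul_assoc]

section Haar

variable {N : ℕ} {A B : Matrix (Fin N) (Fin N) ℂ} {P : Measure (Matrix (Fin N) (Fin N) ℂ)} {z : ℂ}

lemma IsHaarUnitary.restrict_eq (hP : IsHaarUnitary P) :
    P.restrict {U | U ∈ Matrix.unitaryGroup (Fin N) ℂ} = P := by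
  have := hP.1
  refine Measure.restrict_eq_self_of_ae_mem ?_
  exact (prob_compl_eq_zero_iff (isCompact_unitaryGroup N).measurableSet).2 hP.2.1

lemma IsHaarUnitary.integrable_of_continuous (hP : IsHaarUnitary P)
    {f : Matrix (Fin N) (Fin N) ℂ → ℂ} (hf : Continuous f) : Integrable f P := by
  have := hP.1
  rw [← hP.restrict_eq]
  exact hf.continuousOn.integrableOn_compact' (isCompact_unitaryGroup N)
    (isCompact_unitaryGroup N).measurableSet

lemma IsHaarUnitary.integral_mul_left (hP : IsHaarUnitary P)
    {V : Matrix (Fin N) (Fin N) ℂ} (hV : V ∈ Matrix.unitaryGroup (Fin N) ℂ)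
    {f : Matrix (Fin N) (Fin N) ℂ → ℂ} (hf : Continuous f) :
    ∫ U, f (V * U) ∂P = ∫ U, f U ∂P := by
  have hm : Measurable fun U : Matrix (Fin N) (Fin N) ℂ => V * U :=
    (continuous_const.matrix_mul continuous_id).measurable
  conv_rhs => rw [← hP.2.2 V hV]
  exact (integral_map hm.aemeasurable hf.aestronglyMeasurable).symm

lemma integral_resolvent_commutator_eq_zero_of_isHermitian (hA : A.IsHermitian)
    (hB : B.IsHermitian) (hP : IsHaarUnitary P) (hz : z.im ≠ 0)
    {K : Matrix (Fin N) (Fin N) ℂ} (hK : K.IsHermitian) (a b : Fin N) :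
    ∫ U, ((A + U * B * Uᴴ - z • (1 : Matrix (Fin N) (Fin N) ℂ))⁻¹ *
      (K * (U * B * Uᴴ) - (U * B * Uᴴ) * K) *
      (A + U * B * Uᴴ - z • (1 : Matrix (Fin N) (Fin N) ℂ))⁻¹) a b ∂P = 0 := by
  have := hP.1
  set G : Matrix (Fin N) (Fin N) ℂ → Matrix (Fin N) (Fin N) ℂ :=
    fun U => (A + U * B * Uᴴ - z • (1 : Matrix (Fin N) (Fin N) ℂ))⁻¹ with hG
  have hGc : Continuous G := continuous_resolvent_conj hA hB hz
  set F : ℝ → Matrix (Fin N) (Fin N) ℂ → ℂ := fun t U =>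
    (G (cayley K t * U) * ((K * cayleyInv K t * (U * B * Uᴴ) -
      (U * B * Uᴴ) * (K * cayleyInv K t)) * (cayley K t)ᴴ) * G U) a b with hF
  have hFc : Continuous F.uncurry := by
    have hc := (continuous_cayley hK).comp
      (continuous_fst (X := ℝ) (Y := Matrix (Fin N) (Fin N) ℂ))
    have hi := continuous_const.matrix_mul (A := fun _ => K) ((continuous_cayleyInv hK).comp
      (continuous_fst (X := ℝ) (Y := Matrix (Fin N) (Fin N) ℂ)))
    have hb := (continuous_conj B).comp
      (continuous_snd (X := ℝ) (Y := Matrix (Fin N) (Fin N) ℂ))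
    exact (((hGc.comp (hc.matrix_mul continuous_snd)).matrix_mul
      (((hi.matrix_mul hb).sub (hb.matrix_mul hi)).matrix_mul
        hc.matrix_conjTranspose)).matrix_mul (hGc.comp continuous_snd)).matrix_elem a b
  have hcont : Continuous fun t => ∫ U, F t U ∂P := by
    have h := continuous_parametric_integral_of_continuous (μ := P) hFc (isCompact_unitaryGroup N)
    rwa [hP.restrict_eq] at h
  have hzero : ∀ t ≠ 0, ∫ U, F t U ∂P = 0 := by
    intro t ht
    have hGab : Continuous fun U => G U a b := hGc.matrix_elem a b
    have hGV : Continuous fun U => G (cayley K t * U) a b :=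
      hGab.comp (continuous_const.matrix_mul continuous_id)
    have h1 : ∫ U, (G U a b - G (cayley K t * U) a b) ∂P = 0 := by
      rw [integral_sub (hP.integrable_of_continuous hGab) (hP.integrable_of_continuous hGV),
        hP.integral_mul_left (cayley_mem_unitaryGroup hK t) hGab, sub_self]
    have h2 : ∀ U, G U a b - G (cayley K t * U) a b = (2 * t : ℂ) * F t U := fun U =>
      congrFun (congrFun (resolvent_sub_resolvent_cayley hA hB hK hz t U) a) b
    simp_rw [h2] at h1
    rw [integral_const_mul] at h1
    exact (mul_eq_zero.1 h1).resolve_left (by simpa using ht)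
  have hlim : ∫ U, F 0 U ∂P = 0 := by
    have hdense : Dense {t : ℝ | t ≠ 0} := dense_compl_singleton 0
    exact congrFun (hcont.ext_on hdense continuous_const fun t ht => hzero t ht) 0
  have hF0 : ∀ U, F 0 U = I * (G U * (K * (U * B * Uᴴ) - (U * B * Uᴴ) * K) * G U) a b := by
    intro U
    have hV : cayley K 0 = -1 := by
      rw [cayley, cayleyInv_zero hK, smul_smul,
        show 2 * I * -I = 2 by linear_combination (-2) * I_mul_I]
      module
    have hGneg : G (-U) = G U := by simp [hG]
    simp only [hF, hV, cayleyInv_zero hK, Matrix.neg_mul, Matrix.one_mul, hGneg]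
    rw [← smul_eq_mul I, ← Matrix.smul_apply]
    refine congrFun (congrFun ?_ a) b
    simp only [Matrix.conjTranspose_neg, Matrix.conjTranspose_one, Matrix.mul_neg, Matrix.neg_mul,
      Matrix.mul_one, Matrix.mul_smul, Matrix.smul_mul, Matrix.mul_sub, Matrix.sub_mul]
    rw [smul_sub, neg_smul, neg_smul]
    abel
  simp_rw [hF0] at hlim
  rw [integral_const_mul] at hlim
  exact (mul_eq_zero.1 hlim).resolve_left I_ne_zero

lemma integral_resolvent_commutator_eq_zero (hA : A.IsHermitian)
    (hB : B.IsHermitian) (hP : IsHaarUnitary P) (hz : z.im ≠ 0)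
    (X : Matrix (Fin N) (Fin N) ℂ) (a b : Fin N) :
    ∫ U, ((A + U * B * Uᴴ - z • (1 : Matrix (Fin N) (Fin N) ℂ))⁻¹ *
      (X * (U * B * Uᴴ) - (U * B * Uᴴ) * X) *
      (A + U * B * Uᴴ - z • (1 : Matrix (Fin N) (Fin N) ℂ))⁻¹) a b ∂P = 0 := by
  have hGc := continuous_resolvent_conj hA hB hz
  have hint : ∀ K : Matrix (Fin N) (Fin N) ℂ, Integrable (fun U =>
      ((A + U * B * Uᴴ - z • (1 : Matrix (Fin N) (Fin N) ℂ))⁻¹ *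
        (K * (U * B * Uᴴ) - (U * B * Uᴴ) * K) *
        (A + U * B * Uᴴ - z • (1 : Matrix (Fin N) (Fin N) ℂ))⁻¹) a b) P := fun K =>
    hP.integrable_of_continuous (((hGc.matrix_mul (((continuous_const.matrix_mul
      (continuous_conj B)).sub ((continuous_conj B).matrix_mul continuous_const)))).matrix_mul
      hGc).matrix_elem a b)
  set R : Matrix (Fin N) (Fin N) ℂ := (realPart X).1 with hR
  set S : Matrix (Fin N) (Fin N) ℂ := (imaginaryPart X).1 with hS
  have hRS : X = R + I • S := (realPart_add_I_smul_imaginaryPart X).symm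
  have hR' : R.IsHermitian := (realPart X).2
  have hS' : S.IsHermitian := (imaginaryPart X).2
  calc _ = ∫ U, (((A + U * B * Uᴴ - z • (1 : Matrix (Fin N) (Fin N) ℂ))⁻¹ *
        (R * (U * B * Uᴴ) - (U * B * Uᴴ) * R) *
        (A + U * B * Uᴴ - z • (1 : Matrix (Fin N) (Fin N) ℂ))⁻¹) a b +
      I * ((A + U * B * Uᴴ - z • (1 : Matrix (Fin N) (Fin N) ℂ))⁻¹ *
        (S * (U * B * Uᴴ) - (U * B * Uᴴ) * S) *
        (A + U * B * Uᴴ - z • (1 : Matrix (Fin N) (Fin N) ℂ))⁻¹) a b) ∂P := by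
        congr 1 with U
        rw [← smul_eq_mul I, ← Matrix.smul_apply, ← Matrix.add_apply]
        rw [hRS, ← Matrix.smul_mul, ← Matrix.mul_smul, ← Matrix.add_mul, ← Matrix.mul_add,
          Matrix.add_mul, Matrix.mul_add, Matrix.smul_mul, Matrix.mul_smul, smul_sub,
          add_sub_add_comm]
    _ = 0 := by
        rw [integral_add (hint R) ((hint S).const_mul I), integral_const_mul,
          integral_resolvent_commutator_eq_zero_of_isHermitian hA hB hP hz hR',
          integral_resolvent_commutator_eq_zero_of_isHermitian hA hB hP hz hS', mul_zero, add_zero]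

end Haar

/-- **Vanishing expectation from Haar invariance**: for Haar unitary `U`, with
`B̃ = UBU^*` and `G(z) = (A + B̃ - z)⁻¹`,
`E[(B̃G)_{ii} · tr G - G_{ii} · tr(B̃G)] = 0`. -/
theorem haar_invariance_expectation_zero
    (N : ℕ) (hN : 0 < N) (A B : Matrix (Fin N) (Fin N) ℂ)
    (hA : A.IsHermitian) (hB : B.IsHermitian)
    (P : Measure (Matrix (Fin N) (Fin N) ℂ)) (hP : IsHaarUnitary P)
    (z : ℂ) (hz : 0 < z.im) (i : Fin N) :
    ∫ U, (((U * B * Uᴴ) * (A + U * B * Uᴴ - z • (1 : Matrix (Fin N) (Fin N) ℂ))⁻¹) i i *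
        ntr ((A + U * B * Uᴴ - z • (1 : Matrix (Fin N) (Fin N) ℂ))⁻¹) -
      ((A + U * B * Uᴴ - z • (1 : Matrix (Fin N) (Fin N) ℂ))⁻¹) i i *
        ntr ((U * B * Uᴴ) * (A + U * B * Uᴴ - z • (1 : Matrix (Fin N) (Fin N) ℂ))⁻¹)) ∂P
      = 0 := by
  set G : Matrix (Fin N) (Fin N) ℂ → Matrix (Fin N) (Fin N) ℂ :=
    fun U => (A + U * B * Uᴴ - z • (1 : Matrix (Fin N) (Fin N) ℂ))⁻¹ with hG
  have hGc : Continuous G := continuous_resolvent_conj hA hB hz.ne'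
  have hint : ∀ k : Fin N, Integrable (fun U => (G U * (Matrix.single k i (1 : ℂ) * (U * B * Uᴴ) -
      (U * B * Uᴴ) * Matrix.single k i (1 : ℂ)) * G U) k i) P := fun k =>
    hP.integrable_of_continuous ((((hGc.matrix_mul (((continuous_const.matrix_mul
      (continuous_conj B)).sub ((continuous_conj B).matrix_mul continuous_const)))).matrix_mul
      hGc)).matrix_elem k i)
  have key : ∀ U, ((U * B * Uᴴ) * G U) i i * ntr (G U) - G U i i * ntr ((U * B * Uᴴ) * G U) =
      (N : ℂ)⁻¹ * ∑ k : Fin N, (G U * (Matrix.single k i (1 : ℂ) * (U * B * Uᴴ) -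
        (U * B * Uᴴ) * Matrix.single k i (1 : ℂ)) * G U) k i := by
    intro U
    simp only [mul_single_commutator_mul_apply, Finset.sum_sub_distrib, ← Finset.sum_mul]
    rw [ntr, ntr, Matrix.trace_mul_comm (U * B * Uᴴ)]
    simp only [Matrix.trace, Matrix.diag]
    ring
  change ∫ U, (((U * B * Uᴴ) * G U) i i * ntr (G U) - G U i i * ntr ((U * B * Uᴴ) * G U)) ∂P = 0
  simp_rw [key]
  rw [integral_const_mul, integral_finsetSum _ (fun k _ => hint k), Finset.sum_eq_zero, mul_zero]
  exact fun k _ => integral_resolvent_commutator_eq_zero hA hB hP hz.ne' _ k i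


end RMT
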